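/- Let n, m ≥ 1. The number of valid Truchet tilings σ : Fin n × Fin m → ZMod 4 of the n×m grid equals 2^(n+m). -/

import Mathlib

/-- Side `s` of a Truchet cell with orientation `r` is black iff `s = r` or `s = r + 1`
(sides: `0` = top, `1` = right, `2` = bottom, `3` = left). -/
def truchetCol (r s : ZMod 4) : Bool := decide (s = r ∨ s = r + 1)

/-- A Truchet configuration is a valid tiling if adjacent cells meet at differently
coloured sides. -/
def TruchetValid (n m : ℕ) (σ : Fin n × Fin m → ZMod 4) : Prop :=
  (∀ (i i' : Fin n) (j : Fin m), (i' : ℕ) = (i : ℕ) + 1 →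
      truchetCol (σ (i, j)) 1 ≠ truchetCol (σ (i', j)) 3) ∧
  (∀ (i : Fin n) (j j' : Fin m), (j' : ℕ) = (j : ℕ) + 1 →
      truchetCol (σ (i, j)) 2 ≠ truchetCol (σ (i, j')) 0)

/-- A function on `Fin n` that agrees on consecutive arguments is constant. -/
theorem Fin.eq_of_forall_succ_eq {α : Type*} {n : ℕ} {f : Fin n → α}
    (h : ∀ i i' : Fin n, (i' : ℕ) = (i : ℕ) + 1 → f i = f i') (i j : Fin n) : f i = f j := by
  have key : ∀ (k : ℕ) (hk : k < n), f ⟨k, hk⟩ = f ⟨0, by omega⟩ := by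
    intro k
    induction k with
    | zero => intro _; rfl
    | succ k ih =>
      intro hk
      rw [← h ⟨k, by omega⟩ ⟨k + 1, hk⟩ rfl, ih]
  exact (key i i.2).trans (key j j.2).symm

theorem truchetCol_right_ne_left_iff (r s : ZMod 4) :
    truchetCol r 1 ≠ truchetCol s 3 ↔ truchetCol r 1 = truchetCol s 1 := by
  revert r s; decide

theorem truchetCol_bottom_ne_top_iff (r s : ZMod 4) :
    truchetCol r 2 ≠ truchetCol s 0 ↔ truchetCol r 2 = truchetCol s 2 := by
  revert r s; decide

/-- The orientation of a Truchet cell with prescribed right and bottom colours. -/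
def truchetOrientation (a b : Bool) : ZMod 4 :=
  if a then (if b then 1 else 0) else (if b then 2 else 3)

theorem truchetCol_orientation_right (a b : Bool) :
    truchetCol (truchetOrientation a b) 1 = a := by
  revert a b; decide

theorem truchetCol_orientation_bottom (a b : Bool) :
    truchetCol (truchetOrientation a b) 2 = b := by
  revert a b; decide

theorem truchetOrientation_col (r : ZMod 4) :
    truchetOrientation (truchetCol r 1) (truchetCol r 2) = r := by
  revert r; decide

/-- In a valid tiling the right colour depends only on the row and the bottom colour only on
the column. -/
theorem truchetValid_iff {n m : ℕ} (σ : Fin n × Fin m → ZMod 4) :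
    TruchetValid n m σ ↔
      (∀ i i' j, truchetCol (σ (i, j)) 1 = truchetCol (σ (i', j)) 1) ∧
      (∀ i j j', truchetCol (σ (i, j)) 2 = truchetCol (σ (i, j')) 2) := by
  simp only [TruchetValid, truchetCol_right_ne_left_iff, truchetCol_bottom_ne_top_iff]
  refine ⟨fun ⟨h, v⟩ ↦ ⟨fun i i' j ↦ ?_, fun i j j' ↦ ?_⟩,
    fun ⟨h, v⟩ ↦ ⟨fun i i' j _ ↦ h i i' j, fun i j j' _ ↦ v i j j'⟩⟩
  · exact Fin.eq_of_forall_succ_eq (f := fun i ↦ truchetCol (σ (i, j)) 1)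
      (fun i i' ↦ h i i' j) i i'
  · exact Fin.eq_of_forall_succ_eq (f := fun j ↦ truchetCol (σ (i, j)) 2) (v i) j j'

/-- A valid tiling of a nonempty grid amounts to a right colour for each row and a bottom colour
for each column. -/
def truchetTilingEquiv (n m : ℕ) [NeZero n] [NeZero m] :
    {σ : Fin n × Fin m → ZMod 4 // TruchetValid n m σ} ≃ (Fin n → Bool) × (Fin m → Bool) where
  toFun σ := (fun i ↦ truchetCol (σ.1 (i, 0)) 2, fun j ↦ truchetCol (σ.1 (0, j)) 1)
  invFun p := ⟨fun x ↦ truchetOrientation (p.2 x.2) (p.1 x.1), by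
    simp [truchetValid_iff, truchetCol_orientation_right, truchetCol_orientation_bottom]⟩
  left_inv := by
    rintro ⟨σ, hσ⟩
    obtain ⟨h, v⟩ := (truchetValid_iff σ).1 hσ
    ext ⟨i, j⟩ : 2
    dsimp only
    rw [h 0 i j, v i 0 j, truchetOrientation_col]
  right_inv p := by
    simp [truchetCol_orientation_right, truchetCol_orientation_bottom]

/-- There are exactly `2 ^ (n + m)` valid Truchet tilings of the `n × m` grid. -/
theorem truchet_card (n m : ℕ) (hn : 1 ≤ n) (hm : 1 ≤ m) :
    Nat.card {σ : Fin n × Fin m → ZMod 4 // TruchetValid n m σ} = 2 ^ (n + m) := by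
  have : NeZero n := ⟨by omega⟩
  have : NeZero m := ⟨by omega⟩
  rw [Nat.card_congr (truchetTilingEquiv n m)]
  simp [pow_add]
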